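/- arXiv:2109.10511 — 7 statements merged into one kernel-verified Lean document; each statement's English description precedes it below -/
import Mathlib

section
/- Let H = ℓ²(ℕ) with right shift S and left shift T = S*. The smallest complex Lie subalgebra of the algebra of bounded operators on H (with bracket the commutator) that contains S and T equals the linear span of {S} ∪ {T} ∪ {e_m e_n* : m,n ∈ ℕ}, where e_m e_n* denotes the rank-one operator ξ ↦ ⟨e_n, ξ⟩·e_m. In particular this Lie subalgebra is closed under taking adjoints, i.e. it is the *-Lie algebra generated by S and T, and its finite-rank part is exactly the span of all rank-one operators e_m e_n*. -/
open scoped InnerProductSpace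

attribute [local instance 100] LieRing.ofAssociativeRing

/-- in `ℓ²(ℕ)` (abstract Hilbert space `H` with Hilbert basis `e`), the
smallest complex Lie subalgebra of bounded operators containing the right shift `S` and
the left shift `T = S*` is the linear span of `{S} ∪ {T} ∪ {eₘ eₙ* : m,n ∈ ℕ}`; it is
closed under adjoints, and its finite-rank part is exactly the span of the rank-one
operators `eₘ eₙ*`. -/
theorem statement_1
    {H : Type*} [NormedAddCommGroup H] [InnerProductSpace ℂ H] [CompleteSpace H]
    (e : HilbertBasis ℕ ℂ H)
    (S : H →L[ℂ] H) (hS : ∀ n : ℕ, S (e n) = e (n + 1))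
    (T : H →L[ℂ] H) (hT : T = ContinuousLinearMap.adjoint S)
    (rankOne : ℕ → ℕ → (H →L[ℂ] H))
    (hrankOne : ∀ m n : ℕ, rankOne m n = (innerSL ℂ (e n)).smulRight (e m))
    (L : LieSubalgebra ℂ (H →L[ℂ] H))
    (hL : L = LieSubalgebra.lieSpan ℂ (H →L[ℂ] H) {S, T}) :
    (L : Set (H →L[ℂ] H)) =
        (Submodule.span ℂ ({S, T} ∪ Set.range (fun mn : ℕ × ℕ => rankOne mn.1 mn.2)) :
          Submodule ℂ (H →L[ℂ] H)) ∧
      (∀ A : H →L[ℂ] H, A ∈ L → ContinuousLinearMap.adjoint A ∈ L) ∧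
      {A : H →L[ℂ] H | A ∈ L ∧ FiniteDimensional ℂ (LinearMap.range (A : H →ₗ[ℂ] H))} =
        (Submodule.span ℂ (Set.range (fun mn : ℕ × ℕ => rankOne mn.1 mn.2)) :
          Submodule ℂ (H →L[ℂ] H)) := by
  have hon : ∀ i j : ℕ, inner ℂ (e i) (e j) = if i = j then (1 : ℂ) else 0 :=
    fun i j => orthonormal_iff_ite.mp e.orthonormal i j
  have hTi : ∀ x y : H, inner ℂ x (T y) = inner ℂ (S x) y := by
    intro x y
    rw [hT, ContinuousLinearMap.adjoint_inner_right]
  have hTi' : ∀ x y : H, inner ℂ (T x) y = inner ℂ x (S y) := by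
    intro x y
    rw [hT, ContinuousLinearMap.adjoint_inner_left]
  have hext : ∀ x y : H, (∀ i, inner ℂ (e i) x = inner ℂ (e i) y) → x = y := by
    intro x y h
    apply e.repr.injective
    ext i
    rw [e.repr_apply_apply, e.repr_apply_apply, h]
  have hT0 : T (e 0) = 0 := by
    apply hext
    intro i
    rw [hTi, hS, hon]
    simp
  have hTs : ∀ n, T (e (n + 1)) = e n := by
    intro n
    apply hext
    intro i
    rw [hTi, hS, hon, hon]
    simp
  have hE : ∀ m n x, rankOne m n x = inner ℂ (e n) x • e m := by
    intro m n x
    rw [hrankOne]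
    simp
  have hTS : T * S = 1 := by
    ext x
    apply hext
    intro i
    have h1 : inner ℂ (e i) (T (S x)) = inner ℂ (T (S (e i))) x := by
      rw [hTi, hTi']
    simpa [hS, hTs] using h1
  have hST : S * T = 1 - rankOne 0 0 := by
    ext x
    apply hext
    intro i
    have h1 : inner ℂ (e i) (S (T x)) = inner ℂ (S (T (e i))) x := by
      rw [← hTi, hTi']
    change inner ℂ (e i) (S (T x)) = inner ℂ (e i) (x - rankOne 0 0 x)
    rw [h1, hE, inner_sub_right, inner_smul_right, hon]
    cases i with
    | zero => simp [hT0]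
    | succ i => simp [hTs, hS]
  have hSE : ∀ m n, S * rankOne m n = rankOne (m + 1) n := by
    intro m n
    ext x
    simp [hE, hS]
  have hTE0 : ∀ n, T * rankOne 0 n = 0 := by
    intro n
    ext x
    simp [hE, hT0]
  have hTEs : ∀ m n, T * rankOne (m + 1) n = rankOne m n := by
    intro m n
    ext x
    simp [hE, hTs]
  have hET : ∀ m n, rankOne m n * T = rankOne m (n + 1) := by
    intro m n
    ext x
    simp [hE, hTi, hS]
  have hES0 : ∀ m, rankOne m 0 * S = 0 := by
    intro m
    ext x
    simp [hE, ← hTi', hT0]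
  have hESs : ∀ m n, rankOne m (n + 1) * S = rankOne m n := by
    intro m n
    ext x
    simp [hE, ← hTi', hTs]
  have hEE : ∀ m n p q, rankOne m n * rankOne p q = (if n = p then (1 : ℂ) else 0) • rankOne m q := by
    intro m n p q
    ext x
    simp only [mul_apply_eq_comp, smul_apply, hE,
      inner_smul_right, hon, smul_smul]
    rw [mul_comm]
  have hadjE : ∀ m n, ContinuousLinearMap.adjoint (rankOne m n) = rankOne n m := by
    intro m n
    symm
    rw [ContinuousLinearMap.eq_adjoint_iff]
    intro x y
    rw [hE, hE, inner_smul_left, inner_smul_right, inner_conj_symm, mul_comm]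
  have hbr : ∀ A B : H →L[ℂ] H, ⁅A, B⁆ = A * B - B * A :=
    fun A B => LieRing.of_associative_ring_bracket A B
  set R : Set (H →L[ℂ] H) := Set.range (fun mn : ℕ × ℕ => rankOne mn.1 mn.2) with hR
  set M : Submodule ℂ (H →L[ℂ] H) := Submodule.span ℂ ({S, T} ∪ R) with hM
  have hSM : S ∈ M := Submodule.subset_span (by simp)
  have hTM : T ∈ M := Submodule.subset_span (by simp)
  have hEM : ∀ m n, rankOne m n ∈ M := fun m n =>
    Submodule.subset_span (Or.inr ⟨(m, n), rfl⟩)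
  have hSEM : ∀ m n, S * rankOne m n ∈ M := fun m n => by rw [hSE]; exact hEM _ _
  have hETM : ∀ m n, rankOne m n * T ∈ M := fun m n => by rw [hET]; exact hEM _ _
  have hTEM : ∀ m n, T * rankOne m n ∈ M := by
    intro m n
    cases m with
    | zero => rw [hTE0]; exact M.zero_mem
    | succ m => rw [hTEs]; exact hEM _ _
  have hESM : ∀ m n, rankOne m n * S ∈ M := by
    intro m n
    cases n with
    | zero => rw [hES0]; exact M.zero_mem
    | succ m => rw [hESs]; exact hEM _ _
  have hEEM : ∀ m n p q, rankOne m n * rankOne p q ∈ M := by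
    intro m n p q
    rw [hEE]
    exact M.smul_mem _ (hEM _ _)
  have hTSM : T * S - S * T ∈ M := by
    rw [hTS, hST, sub_sub_cancel]
    exact hEM 0 0
  have hgen : ∀ A ∈ ({S, T} ∪ R), ∀ B ∈ ({S, T} ∪ R), A * B - B * A ∈ M := by
    rintro A ((rfl | rfl) | ⟨⟨m, n⟩, rfl⟩) B ((rfl | rfl) | ⟨⟨p, q⟩, rfl⟩)
    · simp
    · rw [← neg_sub]; exact M.neg_mem hTSM
    · exact M.sub_mem (hSEM _ _) (hESM _ _)
    · exact hTSM
    · simp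
    · exact M.sub_mem (hTEM _ _) (hETM _ _)
    · exact M.sub_mem (hESM _ _) (hSEM _ _)
    · exact M.sub_mem (hETM _ _) (hTEM _ _)
    · exact M.sub_mem (hEEM _ _ _ _) (hEEM _ _ _ _)
  have hlie : ∀ A ∈ M, ∀ B ∈ M, A * B - B * A ∈ M := by
    intro A hA B hB
    induction hA using Submodule.span_induction with
    | mem A hA =>
      induction hB using Submodule.span_induction with
      | mem B hB => exact hgen A hA B hB
      | zero => simp
      | add x y _ _ hx hy =>
        have : A * (x + y) - (x + y) * A = (A * x - x * A) + (A * y - y * A) := by noncomm_ring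
        rw [this]; exact M.add_mem hx hy
      | smul c x _ hx =>
        rw [mul_smul_comm, smul_mul_assoc, ← smul_sub]; exact M.smul_mem c hx
    | zero => simp
    | add x y _ _ hx hy =>
      have : (x + y) * B - B * (x + y) = (x * B - B * x) + (y * B - B * y) := by noncomm_ring
      rw [this]; exact M.add_mem hx hy
    | smul c x _ hx =>
      rw [mul_smul_comm, smul_mul_assoc, ← smul_sub]; exact M.smul_mem c hx
  let M' : LieSubalgebra ℂ (H →L[ℂ] H) :=
    { M with lie_mem' := fun {A B} hA hB => (hbr A B).symm ▸ hlie A hA B hB }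
  have hLM : ∀ A, A ∈ L → A ∈ M := by
    intro A hA
    have h : L ≤ M' := by
      rw [hL, LieSubalgebra.lieSpan_le]
      rintro B (rfl | rfl)
      · exact hSM
      · exact hTM
    exact h hA
  have hSL : S ∈ L := by rw [hL]; exact LieSubalgebra.subset_lieSpan (by simp)
  have hTL : T ∈ L := by rw [hL]; exact LieSubalgebra.subset_lieSpan (by simp)
  have hcom : ∀ A ∈ L, ∀ B ∈ L, A * B - B * A ∈ L := by
    intro A hA B hB
    rw [← hbr]; exact L.lie_mem hA hB
  have h00 : rankOne 0 0 ∈ L := by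
    have := hcom T hTL S hSL
    rwa [hTS, hST, sub_sub_cancel] at this
  have hm0 : ∀ m, rankOne m 0 ∈ L := by
    intro m
    induction m with
    | zero => exact h00
    | succ m ih =>
      have := hcom S hSL _ ih
      rwa [hSE, hES0, sub_zero] at this
  have h0n : ∀ n, rankOne 0 n ∈ L := by
    intro n
    induction n with
    | zero => exact h00
    | succ n ih =>
      have := hcom _ ih T hTL
      rwa [hET, hTE0, sub_zero] at this
  have hEL : ∀ m n, rankOne m n ∈ L := by
    intro m n
    have h1 := hcom _ (hm0 m) _ (h0n n)
    rw [hEE, hEE] at h1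
    have h2 := L.add_mem h1 (L.smul_mem (if n = m then (1 : ℂ) else 0) h00)
    simpa using h2
  have hML : ∀ A, A ∈ M → A ∈ L := by
    intro A hA
    have h : M ≤ L.toSubmodule := by
      rw [hM, Submodule.span_le]
      rintro B ((rfl | rfl) | ⟨⟨m, n⟩, rfl⟩)
      · exact hSL
      · exact hTL
      · exact hEL m n
    exact h hA
  have hadjM : ∀ A ∈ M, ContinuousLinearMap.adjoint A ∈ M := by
    intro A hA
    induction hA using Submodule.span_induction with
    | mem A hA =>
      rcases hA with (rfl | rfl) | ⟨⟨m, n⟩, rfl⟩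
      · rw [← hT]; exact hTM
      · rw [hT, ContinuousLinearMap.adjoint_adjoint]; exact hSM
      · rw [hadjE]; exact hEM _ _
    | zero => simp
    | add x y _ _ hx hy => rw [map_add]; exact M.add_mem hx hy
    | smul c x _ hx => rw [map_smulₛₗ]; exact M.smul_mem _ hx
  have hfin : ∀ A ∈ Submodule.span ℂ R,
      FiniteDimensional ℂ (LinearMap.range (A : H →ₗ[ℂ] H)) := by
    intro A hA
    induction hA using Submodule.span_induction with
    | mem A hA =>
      obtain ⟨⟨m, n⟩, rfl⟩ := hA
      refine Submodule.finiteDimensional_of_le (S₂ := Submodule.span ℂ {e m}) ?_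
      rintro _ ⟨x, rfl⟩
      exact Submodule.mem_span_singleton.mpr ⟨inner ℂ (e n) x, (hE m n x).symm⟩
    | zero =>
      refine Submodule.finiteDimensional_of_le (S₂ := (⊥ : Submodule ℂ H)) ?_
      rintro _ ⟨x, rfl⟩
      simp
    | add x y _ _ hx hy =>
      refine Submodule.finiteDimensional_of_le
        (S₂ := LinearMap.range (x : H →ₗ[ℂ] H) ⊔ LinearMap.range (y : H →ₗ[ℂ] H)) ?_
      rintro _ ⟨z, rfl⟩
      exact Submodule.add_mem_sup ⟨z, rfl⟩ ⟨z, rfl⟩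
    | smul c x _ hx =>
      refine Submodule.finiteDimensional_of_le (S₂ := LinearMap.range (x : H →ₗ[ℂ] H)) ?_
      rintro _ ⟨z, rfl⟩
      exact Submodule.smul_mem _ c ⟨z, rfl⟩
  have hST0 : ∀ a b : ℂ,
      FiniteDimensional ℂ (LinearMap.range ((a • S + b • T : H →L[ℂ] H) : H →ₗ[ℂ] H)) →
      a = 0 ∧ b = 0 := by
    intro a b hfd
    by_contra hab
    let v : ℕ → H := fun k => a • e (4 * k + 2) + b • e (4 * k)
    have hv : ∀ k, (a • S + b • T : H →L[ℂ] H) (e (4 * k + 1)) = v k := by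
      intro k
      simp [v, hS, hTs]
    have hne : ∀ k, v k ≠ 0 := by
      intro k h0
      apply hab
      constructor
      · have := congrArg (fun x => inner ℂ (e (4 * k + 2)) x) h0
        simp only [v, inner_add_right, inner_smul_right, hon, inner_zero_right] at this
        simpa using this
      · have := congrArg (fun x => inner ℂ (e (4 * k)) x) h0
        simp only [v, inner_add_right, inner_smul_right, hon, inner_zero_right] at this
        simpa using this
    have horth : Pairwise fun i j => inner ℂ (v i) (v j) = 0 := by
      intro i j hij
      have h1 : 4 * i + 2 ≠ 4 * j := by omega
      have h2 : 4 * i ≠ 4 * j + 2 := by omega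
      have h3 : 4 * i + 2 ≠ 4 * j + 2 := by omega
      have h4 : 4 * i ≠ 4 * j := by omega
      simp only [v, inner_add_right, inner_add_left, inner_smul_right, inner_smul_left, hon,
        if_neg h1, if_neg h2, if_neg h3, if_neg h4]
      simp
    have hli : LinearIndependent ℂ v := linearIndependent_of_ne_zero_of_inner_eq_zero hne horth
    let w : ℕ → LinearMap.range ((a • S + b • T : H →L[ℂ] H) : H →ₗ[ℂ] H) :=
      fun k => ⟨v k, e (4 * k + 1), hv k⟩
    have hw : LinearIndependent ℂ w :=
      LinearIndependent.of_comp (Submodule.subtype _) hli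
    have := hw.finite
    exact not_finite ℕ
  refine ⟨?_, fun A hA => hML _ (hadjM A (hLM A hA)), ?_⟩
  · ext A
    exact ⟨hLM A, hML A⟩
  · ext A
    constructor
    · rintro ⟨hA, hfd⟩
      have hA' := hLM A hA
      rw [hM, Submodule.span_union, Submodule.mem_sup] at hA'
      obtain ⟨G, hG, F, hF, rfl⟩ := hA'
      obtain ⟨a, b, rfl⟩ := Submodule.mem_span_pair.mp hG
      have hFf := hfin F hF
      have hGf : FiniteDimensional ℂ
          (LinearMap.range ((a • S + b • T : H →L[ℂ] H) : H →ₗ[ℂ] H)) := by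
        refine Submodule.finiteDimensional_of_le
          (S₂ := LinearMap.range ((a • S + b • T + F : H →L[ℂ] H) : H →ₗ[ℂ] H) ⊔
            LinearMap.range (F : H →ₗ[ℂ] H)) ?_
        rintro _ ⟨z, rfl⟩
        have h := Submodule.sub_mem _
          (Submodule.mem_sup_left (LinearMap.mem_range_self _ z) :
            (a • S + b • T + F : H →L[ℂ] H) z ∈
              LinearMap.range ((a • S + b • T + F : H →L[ℂ] H) : H →ₗ[ℂ] H) ⊔
                LinearMap.range (F : H →ₗ[ℂ] H))
          (Submodule.mem_sup_right (LinearMap.mem_range_self _ z) :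
            F z ∈
              LinearMap.range ((a • S + b • T + F : H →L[ℂ] H) : H →ₗ[ℂ] H) ⊔
                LinearMap.range (F : H →ₗ[ℂ] H))
        have h2 : (a • S + b • T + F : H →L[ℂ] H) z - F z = (a • S + b • T : H →L[ℂ] H) z := by
          simp
        rw [h2] at h
        exact h
      obtain ⟨rfl, rfl⟩ := hST0 a b hGf
      simpa using hF
    · intro hA
      exact ⟨hML A (Submodule.span_mono Set.subset_union_right hA), hfin A hA⟩
end

section
/- For every t ∈ ℂ, the operator exponential exp(itP) on ℓ²(ℕ) equals the sum of the operator-norm absolutely convergent double series Σ_{m,n ≥ 0} I_{m,n}(t) · S^m T^n, where I_{m,n}(t) := Σ_{p≥0} (−1)^{p+m} · t^{m+n+2p}/(m+n+2p)! · (m+n+1)/(2p+m+n+1) · binom(2p+m+n+1, p). -/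
open scoped InnerProductSpace

/-- The coefficients
`I_{m,n}(t) = Σ_{p≥0} (-1)^{p+m} t^{m+n+2p}/(m+n+2p)! · (m+n+1)/(2p+m+n+1) · C(2p+m+n+1, p)`. -/
noncomputable def Icoef (m n : ℕ) (t : ℂ) : ℂ :=
  ∑' p : ℕ, (-1) ^ (p + m) * t ^ (m + n + 2 * p) / (Nat.factorial (m + n + 2 * p) : ℂ) *
    (((m : ℂ) + n + 1) / (2 * (p : ℂ) + m + n + 1)) * (Nat.choose (2 * p + m + n + 1) p : ℂ)

/-- ballot numbers: nonnegative paths of length `N` from `0` to height `k` -/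
def bal : ℕ → ℕ → ℕ
  | 0, 0 => 1
  | 0, _ + 1 => 0
  | N + 1, 0 => bal N 1
  | N + 1, k + 1 => bal N k + bal N (k + 2)

lemma bal_le (N : ℕ) : ∀ k, bal N k ≤ 2 ^ N := by
  induction N with
  | zero => intro k; cases k <;> simp [bal]
  | succ N ih =>
    intro k
    cases k with
    | zero => have := ih 1; simp only [bal, pow_succ]; omega
    | succ k => have := ih k; have := ih (k + 2); simp only [bal, pow_succ]; omega

lemma bal_zero (N : ℕ) : ∀ k, (∀ p, N ≠ k + 2 * p) → bal N k = 0 := by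
  induction N with
  | zero =>
    intro k h
    cases k with
    | zero => exact absurd rfl (h 0)
    | succ k => simp [bal]
  | succ N ih =>
    intro k h
    cases k with
    | zero =>
      simp only [bal]
      exact ih 1 fun p hp => h (p + 1) (by omega)
    | succ k =>
      simp only [bal]
      rw [ih k fun p hp => h p (by omega), ih (k + 2) fun p hp => h (p + 1) (by omega)]

lemma bal_gt (N k : ℕ) (h : N < k) : bal N k = 0 := bal_zero N k fun p hp => by omega

lemma bal_formula (N : ℕ) : ∀ k p : ℕ, N = k + 2 * p →
    (bal N k : ℂ) = ((k : ℂ) + 1) / (2 * (p : ℂ) + k + 1) * (Nat.choose (2 * p + k + 1) p : ℂ) := by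
  induction N with
  | zero =>
    intro k p h
    obtain rfl : k = 0 := by omega
    obtain rfl : p = 0 := by omega
    simp [bal]
  | succ N ih =>
    intro k p h
    cases k with
    | zero =>
      obtain ⟨q, rfl⟩ : ∃ q, p = q + 1 := ⟨p - 1, by omega⟩
      simp only [bal]
      rw [ih 1 q (by omega)]
      have h1 := Nat.add_one_mul_choose_eq (2 * q + 2) q
      have h2 : ((2 * q + 2 + 1 : ℕ) : ℂ) * ((2 * q + 2).choose q : ℂ)
        = ((2 * q + 2 + 1).choose (q + 1) : ℂ) * ((q + 1 : ℕ) : ℂ) := by exact_mod_cast h1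
      have e1 : 2 * q + 1 + 1 = 2 * q + 2 := rfl
      have e2 : 2 * (q + 1) + 0 + 1 = 2 * q + 2 + 1 := by ring
      rw [e1, e2]
      have p1 : (q : ℂ) + 1 ≠ 0 := by exact_mod_cast Nat.succ_ne_zero q
      have p2 : (2 * q : ℂ) + 1 + 1 ≠ 0 := by exact_mod_cast Nat.succ_ne_zero (2 * q + 1)
      have p3 : (2 : ℂ) * (q + 1) + 0 + 1 ≠ 0 := by
        exact_mod_cast Nat.succ_ne_zero (2 * (q + 1) + 0)
      push_cast at h2 ⊢
      rw [div_mul_eq_mul_div, div_mul_eq_mul_div, div_eq_div_iff p2 p3]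
      linear_combination 2 * h2
    | succ k =>
      simp only [bal]
      cases p with
      | zero =>
        push_cast
        rw [ih k 0 (by omega), bal_gt N (k + 2) (by omega)]
        have p1 : (k : ℂ) + 1 ≠ 0 := by exact_mod_cast Nat.succ_ne_zero k
        have p2 : (k : ℂ) + 1 + 1 ≠ 0 := by exact_mod_cast Nat.succ_ne_zero (k + 1)
        simp [p1, p2]
      | succ p =>
        push_cast
        rw [ih k (p + 1) (by omega), ih (k + 2) p (by omega)]
        have e1 : 2 * (p + 1) + k + 1 = (k + 2 * p + 2) + 1 := by ring
        have e2 : 2 * p + (k + 2) + 1 = (k + 2 * p + 2) + 1 := by ring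
        have e3 : 2 * (p + 1) + (k + 1) + 1 = ((k + 2 * p + 2) + 1) + 1 := by ring
        rw [e1, e2, e3, Nat.choose_succ_succ (k + 2 * p + 2 + 1) p]
        have h1 := Nat.choose_succ_right_eq (k + 2 * p + 2 + 1) p
        rw [show k + 2 * p + 2 + 1 - p = k + p + 3 by omega] at h1
        have h2 : ((k + 2 * p + 2 + 1).choose (p + 1) : ℂ) * (p + 1)
          = ((k + 2 * p + 2 + 1).choose p : ℂ) * (k + p + 3) := by exact_mod_cast h1
        have p1 : (p : ℂ) + 1 ≠ 0 := by exact_mod_cast Nat.succ_ne_zero p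
        have p2 : (2 * p : ℂ) + k + 3 ≠ 0 := by exact_mod_cast Nat.succ_ne_zero (2 * p + k + 2)
        have p3 : (2 * p : ℂ) + k + 4 ≠ 0 := by exact_mod_cast Nat.succ_ne_zero (2 * p + k + 3)
        have h3 := eq_div_of_mul_eq p1 h2
        simp only [Nat.succ_eq_add_one]
        push_cast
        rw [h3]
        rw [show (2 : ℂ) * (p + 1) + k + 1 = 2 * p + k + 3 by ring,
          show (2 : ℂ) * p + (k + 2) + 1 = 2 * p + k + 3 by ring,
          show (2 : ℂ) * (p + 1) + (k + 1) + 1 = 2 * p + k + 4 by ring]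
        field_simp
        ring

section alg
variable {A : Type*} [Ring A] [Algebra ℂ A]

/-- homogeneous sums -/
noncomputable def hs (U V : A) (k : ℕ) : A :=
  ∑ x ∈ Finset.HasAntidiagonal.antidiagonal k, U ^ x.1 * V ^ x.2

lemma hs_succ (U V : A) (k : ℕ) : hs U V (k + 1) = V ^ (k + 1) + U * hs U V k := by
  simp [hs, Finset.Nat.antidiagonal_succ, Finset.mul_sum, pow_succ', mul_assoc]

lemma hs_zero (U V : A) : hs U V 0 = 1 := by simp [hs]

lemma mul_hs_zero (U V : A) : (U + V) * hs U V 0 = hs U V 1 := by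
  simp [hs_zero, hs_succ, add_comm]

lemma mul_hs_succ (U V : A) (h : V * U = 1) (k : ℕ) :
    (U + V) * hs U V (k + 1) = hs U V (k + 2) + hs U V k := by
  rw [add_mul, hs_succ U V (k + 1)]
  conv_lhs => rw [hs_succ U V k]
  rw [mul_add V, ← mul_assoc V U, h, one_mul, ← pow_succ', hs_succ U V k]
  abel

lemma pow_eq_sum (U V : A) (h : V * U = 1) (N : ℕ) :
    ∀ M, N < M → (U + V) ^ N = ∑ k ∈ Finset.range M, (bal N k : ℂ) • hs U V k := by
  induction N with
  | zero =>
    intro M hM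
    obtain ⟨M, rfl⟩ : ∃ q, M = q + 1 := ⟨M - 1, by omega⟩
    rw [Finset.sum_range_succ']
    simp [bal, hs_zero]
  | succ N ih =>
    intro M hM
    obtain ⟨M, rfl⟩ : ∃ q, M = q + 1 := ⟨M - 1, by omega⟩
    rw [pow_succ', ih (M + 1) (by omega), Finset.sum_range_succ', Finset.sum_range_succ', mul_add,
      Finset.mul_sum]
    simp only [mul_smul_comm, mul_hs_zero, mul_hs_succ U V h, bal, smul_add, Nat.cast_add, add_smul,
      Finset.sum_add_distrib]
    have e1 : ∑ k ∈ Finset.range M, (bal N k : ℂ) • hs U V (k + 1) =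
        ∑ k ∈ Finset.range M, (bal N (k + 1) : ℂ) • hs U V (k + 2) + (bal N 0 : ℂ) • hs U V 1 := by
      rw [← Finset.sum_range_succ' (fun k => (bal N k : ℂ) • hs U V (k + 1)),
        Finset.sum_range_succ, bal_gt N M (by omega)]
      simp
    have e2 : ∑ k ∈ Finset.range M, (bal N (k + 1) : ℂ) • hs U V k =
        ∑ k ∈ Finset.range M, (bal N (k + 2) : ℂ) • hs U V (k + 1) + (bal N 1 : ℂ) • hs U V 0 := by
      rw [← Finset.sum_range_succ' (fun k => (bal N (k + 1) : ℂ) • hs U V k),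
        Finset.sum_range_succ, bal_gt N (M + 1) (by omega)]
      simp
    rw [e1, e2]
    abel

end alg

lemma fact_bound (m n p : ℕ) :
    m.factorial * n.factorial * p.factorial ≤ (m + n + 2 * p).factorial := by
  calc _ ≤ (m + n).factorial * p.factorial :=
        Nat.mul_le_mul_right _ (Nat.le_of_dvd (Nat.factorial_pos _)
          (Nat.factorial_mul_factorial_dvd_factorial_add m n))
    _ ≤ (m + n + p).factorial := Nat.le_of_dvd (Nat.factorial_pos _)
          (Nat.factorial_mul_factorial_dvd_factorial_add _ _)
    _ ≤ _ := Nat.factorial_le (by omega)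

/-- scalar coefficient -/
noncomputable def co (t : ℂ) (N : ℕ) (k : ℕ) : ℂ :=
  (Complex.I * t) ^ N / (N.factorial : ℂ) * (bal N k : ℂ)

lemma co_bound (t : ℂ) (m n p : ℕ) : ‖co t (m + n + 2 * p) (m + n)‖ ≤
    ((2 * ‖t‖) ^ m / m.factorial * ((2 * ‖t‖) ^ n / n.factorial)) *
      (((2 * ‖t‖) ^ 2) ^ p / p.factorial) := by
  have hb : (bal (m + n + 2 * p) (m + n) : ℝ) ≤ 2 ^ (m + n + 2 * p) := by
    exact_mod_cast bal_le _ _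
  have hf : ((m.factorial * n.factorial * p.factorial : ℕ) : ℝ) ≤ (m + n + 2 * p).factorial := by
    exact_mod_cast fact_bound m n p
  have : ‖co t (m + n + 2 * p) (m + n)‖ = ‖t‖ ^ (m + n + 2 * p) / (m + n + 2 * p).factorial *
      (bal (m + n + 2 * p) (m + n) : ℝ) := by
    simp [co]
  rw [this]
  calc _ ≤ ‖t‖ ^ (m + n + 2 * p) / ((m.factorial * n.factorial * p.factorial : ℕ) : ℝ) *
        2 ^ (m + n + 2 * p) := by gcongr
    _ = _ := by
      push_cast
      rw [← pow_mul, mul_pow, mul_pow, mul_pow]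
      field_simp
      ring

lemma co_summable (t : ℂ) :
    Summable (fun x : (ℕ × ℕ) × ℕ => ‖co t (x.1.1 + x.1.2 + 2 * x.2) (x.1.1 + x.1.2)‖) := by
  refine Summable.of_nonneg_of_le (fun _ => norm_nonneg _) (fun x => co_bound t x.1.1 x.1.2 x.2) ?_
  have h1 := Real.summable_pow_div_factorial (2 * ‖t‖)
  have h2 := Real.summable_pow_div_factorial ((2 * ‖t‖) ^ 2)
  have h3 := h1.mul_of_nonneg h1 (fun n => by positivity) (fun n => by positivity)
  exact h3.mul_of_nonneg h2 (fun n => by positivity) (fun n => by positivity)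

section main
variable {A : Type*} [NormedRing A] [NormedAlgebra ℂ A] [CompleteSpace A]

lemma hasSum_exp_aux (U V : A) (h : V * U = 1) (hUV : ∀ m n : ℕ, ‖U ^ m * V ^ n‖ ≤ 1) (t : ℂ) :
    HasSum (fun x : (ℕ × ℕ) × ℕ => co t (x.1.1 + x.1.2 + 2 * x.2) (x.1.1 + x.1.2) •
      (U ^ x.1.1 * V ^ x.1.2)) (NormedSpace.exp ((Complex.I * t) • (U + V))) := by
  have hs1 : Summable (fun x : (ℕ × ℕ) × ℕ => co t (x.1.1 + x.1.2 + 2 * x.2) (x.1.1 + x.1.2) •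
      (U ^ x.1.1 * V ^ x.1.2)) := by
    refine Summable.of_norm_bounded (co_summable t) fun x => ?_
    refine (norm_smul_le _ _).trans ?_
    exact mul_le_of_le_one_right (norm_nonneg _) (hUV _ _)
  let g : ℕ × (ℕ × ℕ) → A := fun y => co t y.1 (y.2.1 + y.2.2) • (U ^ y.2.1 * V ^ y.2.2)
  let i : (ℕ × ℕ) × ℕ → ℕ × (ℕ × ℕ) := fun x => (x.1.1 + x.1.2 + 2 * x.2, x.1)
  have hi : Function.Injective i := by
    rintro ⟨⟨m, n⟩, p⟩ ⟨⟨m', n'⟩, p'⟩ hxy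
    simp only [i, Prod.mk.injEq] at hxy ⊢
    omega
  have hg0 : ∀ y ∉ Set.range i, g y = 0 := by
    rintro ⟨N, m, n⟩ hy
    have : bal N (m + n) = 0 := by
      apply bal_zero
      intro p hp
      exact hy ⟨((m, n), p), by simp [i, hp]⟩
    simp [g, co, this]
  have hgs : Summable g := (hi.summable_iff hg0).1 hs1
  have key : HasSum g (NormedSpace.exp ((Complex.I * t) • (U + V))) := by
    have hfib : ∀ N, HasSum (fun c => g (N, c))
        ((N.factorial : ℂ)⁻¹ • ((Complex.I * t) • (U + V)) ^ N) := by
      intro N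
      have hsN : Summable (fun c => g (N, c)) := hgs.prod_factor N
      rw [← (Finset.HasAntidiagonal.sigmaAntidiagonalEquivProd (A := ℕ)).hasSum_iff]
      have hsN' := (Finset.HasAntidiagonal.sigmaAntidiagonalEquivProd (A := ℕ)).summable_iff.2 hsN
      refine HasSum.sigma_of_hasSum (g := fun k => co t N k • hs U V k) ?_ ?_ hsN'
      · have : ((N.factorial : ℂ)⁻¹ • ((Complex.I * t) • (U + V)) ^ N)
          = ∑ k ∈ Finset.range (N + 1), co t N k • hs U V k := by
          rw [smul_pow, pow_eq_sum U V h N (N + 1) (by omega), Finset.smul_sum, Finset.smul_sum]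
          refine Finset.sum_congr rfl fun k _ => ?_
          rw [smul_smul, smul_smul, co]
          congr 1
          ring
        rw [this]
        apply hasSum_sum_of_ne_finset_zero
        intro k hk
        rw [co, bal_gt N k (by simpa using hk)]
        simp
      · intro k
        have := hasSum_fintype (fun c : Finset.HasAntidiagonal.antidiagonal k =>
          ((fun c => g (N, c)) ∘ Finset.HasAntidiagonal.sigmaAntidiagonalEquivProd) ⟨k, c⟩)
        convert this using 1
        rw [hs, Finset.smul_sum, ← Finset.sum_coe_sort (Finset.HasAntidiagonal.antidiagonal k)]
        refine Finset.sum_congr rfl fun c _ => ?_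
        have hc := Finset.HasAntidiagonal.mem_antidiagonal.1 c.2
        simp [g, Finset.HasAntidiagonal.sigmaAntidiagonalEquivProd, hc]
    have h1 := hgs.hasSum.prod_fiberwise hfib
    have h2 := NormedSpace.exp_series_hasSum_exp' (𝕂 := ℂ) ((Complex.I * t) • (U + V))
    rw [← h1.unique h2]
    exact hgs.hasSum
  exact (hi.hasSum_iff hg0).2 key

end main

theorem statement_4
    {H : Type*} [NormedAddCommGroup H] [InnerProductSpace ℂ H] [CompleteSpace H]
    (e : HilbertBasis ℕ ℂ H)
    (S : H →L[ℂ] H) (hS : ∀ n : ℕ, S (e n) = e (n + 1))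
    (T : H →L[ℂ] H) (hT : T = ContinuousLinearMap.adjoint S)
    (P : H →L[ℂ] H) (hP : P = Complex.I • (S - T)) (t : ℂ) :
    HasSum (fun mn : ℕ × ℕ => Icoef mn.1 mn.2 t • (S ^ mn.1 * T ^ mn.2))
        (NormedSpace.exp ((Complex.I * t) • P)) ∧
      Summable (fun mn : ℕ × ℕ => ‖Icoef mn.1 mn.2 t • (S ^ mn.1 * T ^ mn.2)‖) := by
  have hTS : T * S = 1 := by
    refine ContinuousLinearMap.ext_on (s := Set.range e) ?_ ?_
    · have := e.dense_span
      rw [dense_iff_closure_eq, ← Submodule.topologicalClosure_coe, this]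
      rfl
    · rintro _ ⟨n, rfl⟩
      apply e.repr.injective
      ext m
      rw [e.repr_apply_apply, e.repr_apply_apply]
      have ho := orthonormal_iff_ite.1 e.orthonormal
      simp only [mul_apply_eq_comp, one_apply_eq_self]
      rw [hT, ContinuousLinearMap.adjoint_inner_right, hS, hS, ho, ho]
      simp
  have hSn : ‖S‖ ≤ 1 := by
    refine ContinuousLinearMap.opNorm_le_bound _ zero_le_one fun x => ?_
    have h1 : inner ℂ (S x) (S x) = inner ℂ x x := by
      rw [← ContinuousLinearMap.adjoint_inner_right, ← hT]
      have := congrArg (fun F : H →L[ℂ] H => F x) hTS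
      simp only [mul_apply_eq_comp, one_apply_eq_self] at this
      rw [this]
    rw [inner_self_eq_norm_sq_to_K, inner_self_eq_norm_sq_to_K] at h1
    have h2 : ‖S x‖ ^ 2 = ‖x‖ ^ 2 := by exact_mod_cast h1
    rw [one_mul]
    exact (pow_le_pow_iff_left₀ (norm_nonneg _) (norm_nonneg _) two_ne_zero).1 h2.le
  have hTn : ‖T‖ ≤ 1 := by
    rw [hT, LinearIsometryEquiv.norm_map]; exact hSn
  have hpow : ∀ (F : H →L[ℂ] H), ‖F‖ ≤ 1 → ∀ m : ℕ, ‖F ^ m‖ ≤ 1 := by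
    intro F hF m
    induction m with
    | zero => rw [pow_zero]; exact ContinuousLinearMap.norm_id_le
    | succ m ih =>
      rw [pow_succ]
      exact (norm_mul_le _ _).trans (mul_le_one₀ ih (norm_nonneg _) hF)
  have hST : ∀ m n : ℕ, ‖S ^ m * T ^ n‖ ≤ 1 := fun m n =>
    (norm_mul_le _ _).trans (mul_le_one₀ (hpow S hSn m) (norm_nonneg _) (hpow T hTn n))
  have hUVeq : ∀ m n : ℕ, (Complex.I • S) ^ m * ((-Complex.I) • T) ^ n
      = (Complex.I ^ m * (-Complex.I) ^ n) • (S ^ m * T ^ n) := by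
    intro m n
    rw [smul_pow, smul_pow, smul_mul_smul_comm]
  have hUV : ∀ m n : ℕ, ‖(Complex.I • S) ^ m * ((-Complex.I) • T) ^ n‖ ≤ 1 := by
    intro m n
    rw [hUVeq, norm_smul]
    simpa using hST m n
  have hVU : ((-Complex.I) • T) * (Complex.I • S) = 1 := by
    rw [smul_mul_smul_comm, hTS]; simp
  have hsum := hasSum_exp_aux (Complex.I • S) ((-Complex.I) • T) hVU hUV t
  have hPe : Complex.I • S + (-Complex.I) • T = P := by
    rw [hP, smul_sub, neg_smul, sub_eq_add_neg]
  rw [hPe] at hsum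
  -- coefficients
  have hcoef : ∀ m n p : ℕ, (-1) ^ (p + m) * t ^ (m + n + 2 * p) /
      (Nat.factorial (m + n + 2 * p) : ℂ) *
      (((m : ℂ) + n + 1) / (2 * (p : ℂ) + m + n + 1)) * (Nat.choose (2 * p + m + n + 1) p : ℂ)
      = co t (m + n + 2 * p) (m + n) * (Complex.I ^ m * (-Complex.I) ^ n) := by
    intro m n p
    have hI : Complex.I ^ (m + n + 2 * p) * (Complex.I ^ m * (-Complex.I) ^ n) = (-1) ^ (p + m) := by
      calc _ = (Complex.I * Complex.I) ^ m * (Complex.I * -Complex.I) ^ n *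
            (Complex.I * Complex.I) ^ p := by
              rw [mul_pow, mul_pow, mul_pow]; ring
        _ = _ := by
              rw [mul_neg, Complex.I_mul_I]; simp; ring
    rw [co, bal_formula _ (m + n) p rfl, ← hI, mul_pow]
    push_cast
    rw [← add_assoc, ← add_assoc]
    ring
  have hIc : ∀ m n : ℕ, Icoef m n t =
      ∑' p, co t (m + n + 2 * p) (m + n) * (Complex.I ^ m * (-Complex.I) ^ n) := by
    intro m n
    rw [Icoef]
    exact tsum_congr fun p => hcoef m n p
  have hcs := co_summable t
  have hcf : ∀ x : ℕ × ℕ, Summable fun p => ‖co t (x.1 + x.2 + 2 * p) (x.1 + x.2) *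
      (Complex.I ^ x.1 * (-Complex.I) ^ x.2)‖ := by
    intro x
    simpa using hcs.prod_factor x
  constructor
  · simp only [hUVeq, smul_smul] at hsum
    refine hsum.prod_fiberwise fun x => ?_
    have h1 := (hcf x).of_norm.hasSum
    rw [← hIc] at h1
    have h2 := h1.smul_const (S ^ x.1 * T ^ x.2)
    exact h2
  · refine Summable.of_nonneg_of_le (fun _ => norm_nonneg _) (fun x => ?_) hcs.prod
    refine (norm_smul_le _ _).trans ((mul_le_of_le_one_right (norm_nonneg _) (hST _ _)).trans ?_)
    rw [hIc]
    refine (norm_tsum_le_tsum_norm (hcf x)).trans_eq ?_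
    exact tsum_congr fun p => by simp
end

section
/- For every t ∈ ℂ and all k, l ∈ ℕ, the matrix entry of the free momentum evolution satisfies ⟨e_l, exp(itP) e_k⟩ = Σ_{m=0}^{min(l,k)} I_{l−m, k−m}(t). -/
open scoped InnerProductSpace

/-- signed ballot numbers -/
noncomputable def gB : ℕ → ℕ → ℂ
  | 0, s => if s = 0 then 1 else 0
  | N + 1, 0 => - gB N 1
  | N + 1, s + 1 => gB N s - gB N (s + 2)

lemma gB_lt : ∀ (N s : ℕ), N < s → gB N s = 0
  | 0, s, h => by rw [gB, if_neg (by omega)]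
  | N + 1, 0, h => by omega
  | N + 1, s + 1, h => by
      rw [gB, gB_lt N s (by omega), gB_lt N (s + 2) (by omega)]; simp

lemma gB_odd : ∀ (N s : ℕ), (¬ ∃ p, N = s + 2 * p) → gB N s = 0
  | 0, s, h => by
      rw [gB, if_neg]
      rintro rfl
      exact h ⟨0, rfl⟩
  | N + 1, 0, h => by
      rw [gB, gB_odd N 1, neg_zero]
      rintro ⟨p, hp⟩
      exact h ⟨p + 1, by omega⟩
  | N + 1, s + 1, h => by
      rw [gB, gB_odd N s, gB_odd N (s + 2), sub_zero]
      · rintro ⟨p, hp⟩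
        exact h ⟨p + 1, by omega⟩
      · rintro ⟨p, hp⟩
        exact h ⟨p, by omega⟩

lemma gB_closed : ∀ (N s p : ℕ), N = s + 2 * p →
    gB N s = (-1) ^ p * (2 * (N.choose p : ℂ) - ((N + 1).choose p : ℂ))
  | 0, s, p, h => by
      obtain rfl : s = 0 := by omega
      obtain rfl : p = 0 := by omega
      simp [gB]; norm_num
  | N + 1, 0, p, h => by
      obtain ⟨q, rfl⟩ : ∃ q, p = q + 1 := ⟨p - 1, by omega⟩
      obtain rfl : N = 2 * q + 1 := by omega
      rw [gB, gB_closed _ 1 q (by omega)]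
      have h1 : (2 * q + 1).choose (q + 1) = (2 * q + 1).choose q := by
        rw [Nat.choose_symm_half]
      rw [Nat.choose_succ_succ (2 * q + 1 + 1) q, Nat.choose_succ_succ (2 * q + 1) q, h1]
      push_cast
      ring
  | N + 1, s + 1, 0, h => by
      obtain rfl : N = s := by omega
      rw [gB, gB_closed N N 0 (by omega), gB_lt N (N + 2) (by omega)]
      simp
  | N + 1, s + 1, q + 1, h => by
      rw [gB, gB_closed N s (q + 1) (by omega), gB_closed N (s + 2) q (by omega)]
      rw [Nat.choose_succ_succ (N + 1) q, Nat.choose_succ_succ N q]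
      push_cast
      ring

lemma gB_formula (s p : ℕ) :
    gB (s + 2 * p) s = (-1) ^ p * (((s : ℂ) + 1) / (2 * (p : ℂ) + s + 1)) *
      ((2 * p + s + 1).choose p : ℂ) := by
  rw [gB_closed _ s p rfl]
  have h := Nat.choose_mul_succ_eq (s + 2 * p) p
  have h2 : s + 2 * p + 1 - p = s + p + 1 := by omega
  rw [h2] at h
  have h3 : (((s + 2 * p).choose p : ℕ) : ℂ) * ((s : ℂ) + 2 * p + 1) =
      ((s + 2 * p + 1).choose p : ℂ) * ((s : ℂ) + p + 1) := by exact_mod_cast h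
  have h4 : (2 * (p : ℂ) + s + 1) ≠ 0 := by
    have : 2 * p + s + 1 ≠ 0 := by omega
    exact_mod_cast this
  rw [show 2 * p + s + 1 = s + 2 * p + 1 by ring, mul_assoc]
  congr 1
  rw [div_mul_eq_mul_div, eq_div_iff h4]
  linear_combination 2 * h3

/-- candidate matrix entries -/
noncomputable def dB (N l k : ℕ) : ℂ :=
  ∑ m ∈ Finset.range (min l k + 1), (-1) ^ (l - m) * gB N ((l - m) + (k - m))

lemma dB_zero (l k : ℕ) : dB 0 l k = if l = k then 1 else 0 := by
  unfold dB
  split_ifs with h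
  · subst h
    rw [min_self, Finset.sum_range_succ, Finset.sum_eq_zero]
    · simp [gB]
    · intro m hm
      rw [Finset.mem_range] at hm
      rw [gB, if_neg (by omega), mul_zero]
  · apply Finset.sum_eq_zero
    intro m hm
    rw [Finset.mem_range] at hm
    rw [gB, if_neg (by omega), mul_zero]

lemma gB_succ (N s : ℕ) (h : s ≠ 0) : gB (N + 1) s = gB N (s - 1) - gB N (s + 1) := by
  obtain ⟨r, rfl⟩ : ∃ r, s = r + 1 := ⟨s - 1, by omega⟩
  rw [gB]; rfl

lemma dB_succ_zero (N l : ℕ) : dB (N + 1) l 0 = - dB N l 1 := by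
  unfold dB
  rcases l with _ | l
  · simp [gB]
  · have h1 : min (l + 1) 1 = 1 := by omega
    simp [h1, Finset.sum_range_succ, gB, pow_succ]
    ring

lemma dB_succ_succ (N l k : ℕ) : dB (N + 1) l (k + 1) = dB N l k - dB N l (k + 2) := by
  unfold dB
  rcases lt_trichotomy l (k + 1) with h | h | h
  · rw [min_eq_left (by omega), min_eq_left (by omega), min_eq_left (by omega),
      ← Finset.sum_sub_distrib]
    apply Finset.sum_congr rfl
    intro m hm
    rw [Finset.mem_range] at hm
    rw [gB_succ _ _ (by omega), mul_sub]
    congr 3 <;> omega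
  · subst h
    rw [min_eq_left (by omega), min_eq_right (by omega), min_eq_left (by omega),
      Finset.sum_range_succ, Finset.sum_range_succ _ (k + 1)]
    have : ∑ x ∈ Finset.range (k + 1), (-1) ^ (k + 1 - x) * gB (N + 1) (k + 1 - x + (k + 1 - x))
      = ∑ x ∈ Finset.range (k + 1), (-1) ^ (k + 1 - x) * gB N (k + 1 - x + (k - x))
       - ∑ x ∈ Finset.range (k + 1), (-1) ^ (k + 1 - x) * gB N (k + 1 - x + (k + 2 - x)) := by
      rw [← Finset.sum_sub_distrib]
      apply Finset.sum_congr rfl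
      intro m hm
      rw [Finset.mem_range] at hm
      rw [gB_succ _ _ (by omega), mul_sub]
      congr 3 <;> omega
    rw [this]
    have h2 : k + 2 - (k + 1) = 1 := by omega
    simp only [Nat.sub_self, h2, gB]
    ring
  · rw [min_eq_right (by omega), min_eq_right (by omega), min_eq_right (by omega),
      Finset.sum_range_succ, Finset.sum_range_succ _ (k + 2), Finset.sum_range_succ _ (k + 1)]
    have : ∑ x ∈ Finset.range (k + 1), (-1) ^ (l - x) * gB (N + 1) (l - x + (k + 1 - x))
      = ∑ x ∈ Finset.range (k + 1), (-1) ^ (l - x) * gB N (l - x + (k - x))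
       - ∑ x ∈ Finset.range (k + 1), (-1) ^ (l - x) * gB N (l - x + (k + 2 - x)) := by
      rw [← Finset.sum_sub_distrib]
      apply Finset.sum_congr rfl
      intro m hm
      rw [Finset.mem_range] at hm
      rw [gB_succ _ _ (by omega), mul_sub]
      congr 3 <;> omega
    rw [this]
    obtain ⟨r, rfl⟩ : ∃ r, l = k + 2 + r := ⟨l - (k + 2), by omega⟩
    have h2 : k + 2 - (k + 1) = 1 := by omega
    have h3 : k + 2 + r - (k + 1) = r + 1 := by omega
    have h4 : k + 2 + r - (k + 2) = r := by omega
    simp only [Nat.sub_self, h2, h3, h4, gB, add_zero, pow_succ]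
    ring

lemma Icoef_eq (m n : ℕ) (t : ℂ) :
    Icoef m n t = ∑' N : ℕ, ((N.factorial : ℂ)⁻¹ * t ^ N) * ((-1) ^ m * gB N (m + n)) := by
  have hinj : Function.Injective (fun p : ℕ => m + n + 2 * p) := by
    intro a b h
    simp only at h
    omega
  rw [← hinj.tsum_eq]
  · unfold Icoef
    apply tsum_congr
    intro p
    rw [gB_formula]
    rw [show 2 * p + (m + n) + 1 = 2 * p + m + n + 1 by ring]
    push_cast
    rw [show 2 * (p : ℂ) + (m + n) + 1 = 2 * p + m + n + 1 by ring, pow_add (-1 : ℂ) p m]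
    ring
  · intro N hN
    by_contra hc
    apply hN
    simp only
    rw [gB_odd, mul_zero, mul_zero]
    rintro ⟨p, hp⟩
    exact hc ⟨p, hp.symm⟩

section
variable {H : Type*} [NormedAddCommGroup H] [InnerProductSpace ℂ H] [CompleteSpace H]

lemma inner_e (e : HilbertBasis ℕ ℂ H) (i j : ℕ) : ⟪e i, e j⟫_ℂ = if i = j then 1 else 0 :=
  orthonormal_iff_ite.mp e.orthonormal i j

lemma ext_e (e : HilbertBasis ℕ ℂ H) (x y : H) (h : ∀ j, ⟪e j, x⟫_ℂ = ⟪e j, y⟫_ℂ) : x = y := by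
  apply e.repr.injective
  ext j
  rw [e.repr_apply_apply, e.repr_apply_apply, h]

lemma adj_zero (e : HilbertBasis ℕ ℂ H)
    (S : H →L[ℂ] H) (hS : ∀ n : ℕ, S (e n) = e (n + 1)) :
    ContinuousLinearMap.adjoint S (e 0) = 0 := by
  apply ext_e e
  intro j
  rw [ContinuousLinearMap.adjoint_inner_right, hS, inner_e, inner_zero_right, if_neg (by omega)]

lemma adj_succ (e : HilbertBasis ℕ ℂ H)
    (S : H →L[ℂ] H) (hS : ∀ n : ℕ, S (e n) = e (n + 1)) (k : ℕ) :
    ContinuousLinearMap.adjoint S (e (k + 1)) = e k := by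
  apply ext_e e
  intro j
  rw [ContinuousLinearMap.adjoint_inner_right, hS, inner_e, inner_e]
  simp

lemma inner_pow (e : HilbertBasis ℕ ℂ H)
    (S : H →L[ℂ] H) (hS : ∀ n : ℕ, S (e n) = e (n + 1)) (N : ℕ) : ∀ (l k : ℕ),
    ⟪e l, ((ContinuousLinearMap.adjoint S - S) ^ N) (e k)⟫_ℂ = dB N l k := by
  induction N with
  | zero => intro l k; simp [dB_zero, inner_e]
  | succ N ih =>
    intro l k
    rw [pow_succ, ContinuousLinearMap.mul_apply, ContinuousLinearMap.sub_apply, hS]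
    rcases k with _ | k
    · rw [adj_zero e S hS, zero_sub, map_neg, inner_neg_right, ih, dB_succ_zero]
    · rw [adj_succ e S hS, map_sub, inner_sub_right, ih, ih, dB_succ_succ]

lemma hasSum_exp_entry (e : HilbertBasis ℕ ℂ H)
    (S : H →L[ℂ] H) (hS : ∀ n : ℕ, S (e n) = e (n + 1)) (t : ℂ) (l k : ℕ) :
    HasSum (fun N : ℕ => ((N.factorial : ℂ)⁻¹ * t ^ N) * dB N l k)
      ⟪e l, NormedSpace.exp (t • (ContinuousLinearMap.adjoint S - S)) (e k)⟫_ℂ := by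
  have h := NormedSpace.exp_series_hasSum_exp' (𝕂 := ℂ)
    (t • (ContinuousLinearMap.adjoint S - S))
  have h2 := ((innerSL ℂ (e l)).comp (ContinuousLinearMap.apply ℂ H (e k))).hasSum h
  have h3 : (fun N : ℕ => ((N.factorial : ℂ)⁻¹ * t ^ N) * dB N l k) = fun N : ℕ =>
      ((innerSL ℂ (e l)).comp (ContinuousLinearMap.apply ℂ H (e k)))
        ((N.factorial : ℂ)⁻¹ • (t • (ContinuousLinearMap.adjoint S - S)) ^ N) := by
    funext N
    rw [smul_pow, map_smul, map_smul, ← inner_pow e S hS, smul_eq_mul, smul_eq_mul, mul_assoc]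
    rfl
  rw [h3]
  exact h2

end

/-- `⟨e_l, exp(itP) e_k⟩ = Σ_{m=0}^{min(l,k)} I_{l-m,k-m}(t)`. -/
theorem statement_6
    {H : Type*} [NormedAddCommGroup H] [InnerProductSpace ℂ H] [CompleteSpace H]
    (e : HilbertBasis ℕ ℂ H)
    (S : H →L[ℂ] H) (hS : ∀ n : ℕ, S (e n) = e (n + 1))
    (T : H →L[ℂ] H) (hT : T = ContinuousLinearMap.adjoint S)
    (P : H →L[ℂ] H) (hP : P = Complex.I • (S - T)) (t : ℂ) (k l : ℕ) :
    ⟪e l, NormedSpace.exp ((Complex.I * t) • P) (e k)⟫_ℂ =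
      ∑ m ∈ Finset.range (min l k + 1), Icoef (l - m) (k - m) t := by
  have hX : (Complex.I * t) • P = t • (ContinuousLinearMap.adjoint S - S) := by
    rw [hP, hT, smul_smul, show Complex.I * t * Complex.I = -t by
      linear_combination t * Complex.I_mul_I, neg_smul, ← smul_neg, neg_sub]
  rw [hX, ← (hasSum_exp_entry e S hS t l k).tsum_eq]
  simp only [Icoef_eq]
  rw [← Summable.tsum_finsetSum]
  · apply tsum_congr
    intro N
    rw [dB, Finset.mul_sum]
  · intro m _
    have h := (hasSum_exp_entry e S hS t 0 (l - m + (k - m))).summable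
    refine (h.mul_left ((-1) ^ (l - m))).congr ?_
    intro N
    simp [dB]
    ring
end

section
/- For every t ∈ ℂ with t ≠ 0 and every l ∈ ℕ, ⟨e_l, exp(itP) e₀⟩ = (−1)^l (l+1) J_{l+1}(2t)/t; equivalently, exp(itP) e₀ = (1/t) Σ_{l≥0} (−1)^l (l+1) J_{l+1}(2t) e_l in ℓ²(ℕ). -/
open scoped InnerProductSpace

/-- Bessel function of the first kind of integer order `n`:
`J_n(z) = Σ_{p≥0} (-1)^p/(p!(n+p)!) (z/2)^{n+2p}`. -/
noncomputable def besselJ (n : ℕ) (z : ℂ) : ℂ :=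
  ∑' p : ℕ, ((-1) ^ p / ((Nat.factorial p : ℂ) * (Nat.factorial (n + p) : ℂ))) *
    (z / 2) ^ (n + 2 * p)

theorem coeff_rec (a : ℕ → ℕ → ℂ) (h00 : a 0 0 = 1) (h0 : ∀ l, a 0 (l + 1) = 0)
    (hz : ∀ n, a (n + 1) 0 = a n 1) (hs : ∀ n l, a (n + 1) (l + 1) = a n (l + 2) - a n l) (n : ℕ) :
    (∀ l p, n = l + 2 * p → a n l = (-1) ^ l * (-1) ^ p * ((l : ℂ) + 1) * (n.factorial : ℂ) /
      ((p.factorial : ℂ) * ((l + 1 + p).factorial : ℂ))) ∧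
    (∀ l, (∀ p, n ≠ l + 2 * p) → a n l = 0) := by
  have hf : ∀ k : ℕ, (k.factorial : ℂ) ≠ 0 := fun k => by exact_mod_cast k.factorial_ne_zero
  have hk : ∀ k : ℕ, ((k : ℂ) + 1) ≠ 0 := fun k => by exact_mod_cast k.succ_ne_zero
  induction n with
  | zero =>
    refine ⟨?_, ?_⟩
    · intro l p h
      obtain rfl : l = 0 := by omega
      obtain rfl : p = 0 := by omega
      simp [h00]
    · intro l h
      cases l with
      | zero => exact absurd rfl (h 0)
      | succ l => exact h0 l
  | succ n ih =>
    obtain ⟨ih1, ih2⟩ := ih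
    refine ⟨?_, ?_⟩
    · intro l p h
      cases l with
      | zero =>
        obtain ⟨q, rfl⟩ : ∃ q, p = q + 1 := ⟨p - 1, by omega⟩
        obtain rfl : n = 1 + 2 * q := by omega
        rw [hz, ih1 1 q rfl, show 1 + 1 + q = 0 + 1 + (q + 1) by ring,
          Nat.factorial_succ (1 + 2 * q), Nat.factorial_succ q]
        have := hf q
        have := hf (0 + 1 + (q + 1))
        have := hk q
        push_cast
        field_simp
        ring
      | succ m =>
        obtain rfl : n = m + 2 * p := by omega
        rw [hs, ih1 m p rfl]
        cases p with
        | zero =>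
          rw [ih2 (m + 2) (by intro p; omega)]
          simp only [Nat.mul_zero, Nat.add_zero, Nat.factorial_succ]
          have := hf m
          have := hk m
          have : (m : ℂ) + 1 + 1 ≠ 0 := by exact_mod_cast hk (m + 1)
          push_cast
          field_simp
          ring
        | succ q =>
          rw [ih1 (m + 2) q (by ring), Nat.factorial_succ (m + 2 * (q + 1)),
            show m + 2 + 1 + q = (m + q + 2) + 1 by ring,
            show m + 1 + (q + 1) = (m + q + 2) by ring,
            show m + 1 + 1 + (q + 1) = (m + q + 2) + 1 by ring,
            Nat.factorial_succ (m + q + 2), Nat.factorial_succ q]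
          have := hf q
          have := hf (m + q + 2)
          have := hf (m + 2 * (q + 1))
          have := hk q
          have : (m : ℂ) + q + 2 + 1 ≠ 0 := by exact_mod_cast hk (m + q + 2)
          push_cast
          field_simp
          ring
    · intro l h
      cases l with
      | zero =>
        rw [hz]
        exact ih2 1 (fun p hp => h (p + 1) (by omega))
      | succ m =>
        rw [hs, ih2 m (fun p hp => h p (by omega)),
          ih2 (m + 2) (fun p hp => h (p + 1) (by omega)), sub_zero]

/-- for `t ≠ 0`, `⟨e_l, exp(itP) e₀⟩ = (-1)^l (l+1) J_{l+1}(2t)/t`;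
equivalently `exp(itP) e₀ = (1/t) Σ_{l≥0} (-1)^l (l+1) J_{l+1}(2t) e_l` in `ℓ²(ℕ)`. -/
theorem statement_7
    {H : Type*} [NormedAddCommGroup H] [InnerProductSpace ℂ H] [CompleteSpace H]
    (e : HilbertBasis ℕ ℂ H)
    (S : H →L[ℂ] H) (hS : ∀ n : ℕ, S (e n) = e (n + 1))
    (T : H →L[ℂ] H) (hT : T = ContinuousLinearMap.adjoint S)
    (P : H →L[ℂ] H) (hP : P = Complex.I • (S - T)) (t : ℂ) (ht : t ≠ 0) :
    (∀ l : ℕ, ⟪e l, NormedSpace.exp ((Complex.I * t) • P) (e 0)⟫_ℂ =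
        (-1) ^ l * ((l : ℂ) + 1) * besselJ (l + 1) (2 * t) / t) ∧
      HasSum (fun l : ℕ => ((1 / t) * ((-1) ^ l * ((l : ℂ) + 1) * besselJ (l + 1) (2 * t))) • e l)
        (NormedSpace.exp ((Complex.I * t) • P) (e 0)) := by
  have hin : ∀ i j : ℕ, ⟪e i, e j⟫_ℂ = if i = j then 1 else 0 :=
    orthonormal_iff_ite.mp e.orthonormal
  have hT' : ∀ x y : H, ⟪x, T y⟫_ℂ = ⟪S x, y⟫_ℂ := fun x y => by
    rw [hT, ContinuousLinearMap.adjoint_inner_right]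
  have hS' : ∀ x y : H, ⟪x, S y⟫_ℂ = ⟪T x, y⟫_ℂ := fun x y => by
    rw [hT, ContinuousLinearMap.adjoint_inner_left]
  have hT0 : T (e 0) = 0 := by
    apply e.repr.injective
    ext i
    rw [e.repr_apply_apply, hT', hS, hin]
    simp
  have hTs : ∀ n, T (e (n + 1)) = e n := fun n => by
    apply e.repr.injective
    ext i
    rw [e.repr_apply_apply, hT', hS, hin, e.repr_apply_apply, hin]
    simp
  have hA : (Complex.I * t) • P = t • (T - S) := by
    rw [hP, smul_smul, show Complex.I * t * Complex.I = -t by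
      linear_combination t * Complex.I_mul_I, neg_smul, ← smul_neg, neg_sub]
  have key := coeff_rec (fun n l => ⟪e l, ((T - S) ^ n) (e 0)⟫_ℂ)
    (by simpa using hin 0 0) (by intro l; simpa using hin (l + 1) 0)
    (by
      intro n
      simp only [pow_succ', mul_apply_eq_comp, sub_apply,
        inner_sub_right, hT', hS', hS, hT0, inner_zero_left, sub_zero])
    (by
      intro n l
      simp only [pow_succ', mul_apply_eq_comp, sub_apply,
        inner_sub_right, hT', hS', hS, hTs])
  have main : ∀ l : ℕ, ⟪e l, NormedSpace.exp ((Complex.I * t) • P) (e 0)⟫_ℂ =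
        (-1) ^ l * ((l : ℂ) + 1) * besselJ (l + 1) (2 * t) / t := by
    intro l
    rw [hA]
    have h1 := NormedSpace.exp_series_hasSum_exp' (𝕂 := ℂ) (t • (T - S))
    have h2 := ((innerSL ℂ (e l)).comp (ContinuousLinearMap.apply ℂ H (e 0))).hasSum h1
    have hinj : Function.Injective (fun p : ℕ => l + 2 * p) := by
      intro p q h
      simp only at h
      omega
    rw [← hinj.hasSum_iff] at h2
    · have h3 : HasSum (fun p : ℕ => (-1) ^ l * ((l : ℂ) + 1) / t *
          (((-1) ^ p / ((Nat.factorial p : ℂ) * (Nat.factorial (l + 1 + p) : ℂ))) *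
            (2 * t / 2) ^ (l + 1 + 2 * p)))
          ⟪e l, NormedSpace.exp (t • (T - S)) (e 0)⟫_ℂ := by
        have h4 : HasSum (fun p : ℕ => ⟪e l, ((((l + 2 * p).factorial : ℂ)⁻¹) •
            (t • (T - S)) ^ (l + 2 * p)) (e 0)⟫_ℂ)
            ⟪e l, NormedSpace.exp (t • (T - S)) (e 0)⟫_ℂ := h2
        convert h4 using 1
        funext p
        have := (key (l + 2 * p)).1 l p rfl
        simp only [Function.comp, ContinuousLinearMap.comp_apply, ContinuousLinearMap.apply_apply,
          innerSL_apply_apply, smul_apply, smul_pow, inner_smul_right, this]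
        have h1 : ((l + 2 * p).factorial : ℂ) ≠ 0 := by exact_mod_cast Nat.factorial_ne_zero _
        have h2 : (p.factorial : ℂ) ≠ 0 := by exact_mod_cast Nat.factorial_ne_zero _
        have h3 : ((l + 1 + p).factorial : ℂ) ≠ 0 := by exact_mod_cast Nat.factorial_ne_zero _
        rw [mul_div_cancel_left₀ t two_ne_zero]
        field_simp
        ring
      rw [← h3.tsum_eq, tsum_mul_left, besselJ]
      ring
    · intro n hn
      have := (key n).2 l (fun p hp => hn ⟨p, hp.symm⟩)
      simp only [ContinuousLinearMap.comp_apply, ContinuousLinearMap.apply_apply,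
          innerSL_apply_apply, smul_apply, smul_pow, inner_smul_right, this,
          mul_zero]
  refine ⟨main, ?_⟩
  convert e.hasSum_repr (NormedSpace.exp ((Complex.I * t) • P) (e 0)) using 1
  funext l
  rw [e.repr_apply_apply, main]
  congr 1
  ring
end

section
/- For every t ∈ ℂ, the vacuum expectations of the two evolution groups coincide: ⟨e₀, exp(itP) e₀⟩ = ⟨e₀, exp(itX) e₀⟩ = Σ_{p≥0} (−t²)^p C_p/(2p)!, and for t ≠ 0 this common value equals J₁(2t)/t. -/
open scoped InnerProductSpace

theorem aux_adj
    {H : Type*} [NormedAddCommGroup H] [InnerProductSpace ℂ H] [CompleteSpace H]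
    (e : HilbertBasis ℕ ℂ H)
    (S : H →L[ℂ] H) (hS : ∀ n : ℕ, S (e n) = e (n + 1)) (v : H) :
    ⟪e 0, S v⟫_ℂ = 0 ∧ ∀ k, ⟪e (k + 1), S v⟫_ℂ = ⟪e k, v⟫_ℂ := by
  have ho := e.orthonormal
  rw [orthonormal_iff_ite] at ho
  have h0 : ContinuousLinearMap.adjoint S (e 0) = 0 := by
    apply e.repr.injective
    ext n
    rw [e.repr_apply_apply, e.repr_apply_apply, ContinuousLinearMap.adjoint_inner_right, hS, ho]
    simp
  have h1 : ∀ k, ContinuousLinearMap.adjoint S (e (k + 1)) = e k := by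
    intro k
    apply e.repr.injective
    ext n
    rw [e.repr_apply_apply, e.repr_apply_apply, ContinuousLinearMap.adjoint_inner_right, hS, ho, ho]
    simp
  refine ⟨?_, fun k => ?_⟩
  · rw [← ContinuousLinearMap.adjoint_inner_left, h0, inner_zero_left]
  · rw [← ContinuousLinearMap.adjoint_inner_left, h1]

theorem aux_rec (g : ℕ → ℕ → ℂ) (α β : ℂ) (hab : α * β = 1)
    (g0 : g 0 0 = 1) (g0' : ∀ k, g 0 (k + 1) = 0)
    (gs : ∀ n, g (n + 1) 0 = β * g n 1)
    (gs' : ∀ n k, g (n + 1) (k + 1) = α * g n k + β * g n (k + 2)) (n : ℕ) :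
    ∀ k, (∀ p, n = 2 * p + k → g n k = α ^ k * ((n.factorial : ℂ) * (k + 1) /
      ((p.factorial : ℂ) * ((p + k + 1).factorial : ℂ)))) ∧
      ((∀ p, n ≠ 2 * p + k) → g n k = 0) := by
  induction n with
  | zero =>
    intro k
    refine ⟨fun p hp => ?_, fun h => ?_⟩
    · obtain rfl : p = 0 := by omega
      obtain rfl : k = 0 := by omega
      simp [g0]
    · rcases k with _ | k
      · exact absurd rfl (h 0)
      · exact g0' k
  | succ n ih =>
    intro k
    refine ⟨fun p hp => ?_, fun h => ?_⟩
    · rcases k with _ | k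
      · obtain ⟨q, rfl⟩ : ∃ q, p = q + 1 := ⟨p - 1, by omega⟩
        rw [gs, (ih 1).1 q (by omega)]
        obtain rfl : n = 2 * q + 1 := by omega
        have h1 : (q.factorial : ℂ) ≠ 0 := by exact_mod_cast q.factorial_ne_zero
        have h2 : ((q + 1 + 1).factorial : ℂ) ≠ 0 := by exact_mod_cast (q + 1 + 1).factorial_ne_zero
        have h3 : (q : ℂ) + 1 ≠ 0 := by exact_mod_cast q.succ_ne_zero
        rw [Nat.factorial_succ (2 * q + 1), Nat.factorial_succ q]
        simp only [Nat.add_zero]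
        push_cast
        field_simp
        linear_combination (2 * ((2 * q + 1).factorial : ℂ) * ((q : ℂ) + 1)) * hab
      · rw [gs', (ih k).1 p (by omega)]
        rcases p with _ | q
        · rw [(ih (k + 2)).2 (by intro p; omega)]
          obtain rfl : n = k := by omega
          have h2 : ((n).factorial : ℂ) ≠ 0 := by exact_mod_cast (n).factorial_ne_zero
          have h3 : (n : ℂ) + 1 ≠ 0 := by exact_mod_cast n.succ_ne_zero
          have h4 : (n : ℂ) + 1 + 1 ≠ 0 := by exact_mod_cast (n+1).succ_ne_zero
          simp only [Nat.factorial_succ, Nat.factorial_zero, Nat.zero_add]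
          push_cast
          field_simp
          ring
        · rw [(ih (k + 2)).1 q (by omega)]
          obtain rfl : n = 2 * q + k + 2 := by omega
          have h1 : (q.factorial : ℂ) ≠ 0 := by exact_mod_cast q.factorial_ne_zero
          have h2 : ((q + k + 2).factorial : ℂ) ≠ 0 := by exact_mod_cast (q + k + 2).factorial_ne_zero
          have h3 : (q : ℂ) + 1 ≠ 0 := by exact_mod_cast q.succ_ne_zero
          have h4 : (q : ℂ) + k + 2 + 1 ≠ 0 := by exact_mod_cast (q + k + 2).succ_ne_zero
          rw [Nat.factorial_succ (2 * q + k + 2), Nat.factorial_succ q,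
            show q + 1 + k + 1 = q + k + 2 by ring, show q + (k + 2) + 1 = q + k + 2 + 1 by ring,
            show q + 1 + (k + 1) + 1 = q + k + 2 + 1 by ring, Nat.factorial_succ (q + k + 2)]
          have e1 : β * (α ^ (k + 2)) = α ^ (k + 1) := by
            linear_combination α ^ (k + 1) * hab
          rw [← mul_assoc, ← mul_assoc β, e1, ← pow_succ', ← mul_add]
          congr 1
          push_cast
          field_simp
          ring
    · rcases k with _ | k
      · rw [gs, (ih 1).2 (by intro p hp; exact h (p + 1) (by omega)), mul_zero]
      · rw [gs', (ih k).2 (by intro p hp; exact h p (by omega)),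
          (ih (k + 2)).2 (by intro p hp; exact h (p + 1) (by omega))]
        simp

theorem aux_exp
    {H : Type*} [NormedAddCommGroup H] [InnerProductSpace ℂ H] [CompleteSpace H]
    (e : HilbertBasis ℕ ℂ H)
    (S : H →L[ℂ] H) (hS : ∀ n : ℕ, S (e n) = e (n + 1)) (α β : ℂ) (hab : α * β = 1)
    (A : H →L[ℂ] H) (hA : A = α • S + β • ContinuousLinearMap.adjoint S) (t : ℂ) :
    ⟪e 0, NormedSpace.exp ((Complex.I * t) • A) (e 0)⟫_ℂ =
      ∑' p : ℕ, (-t ^ 2) ^ p / ((p.factorial : ℂ) * ((p + 1).factorial : ℂ)) := by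
  have ho := e.orthonormal
  rw [orthonormal_iff_ite] at ho
  have key := aux_rec (fun n k => ⟪e k, (A ^ n) (e 0)⟫_ℂ) α β hab
    (by simp only [pow_zero, ContinuousLinearMap.one_apply, ho]; simp)
    (by intro k; simp only [pow_zero, ContinuousLinearMap.one_apply, ho]; simp)
    (by
      intro n
      simp only [pow_succ', ContinuousLinearMap.mul_apply]
      generalize (A ^ n) (e 0) = v
      simp [hA, inner_add_right, inner_smul_right, (aux_adj e S hS v).1,
        ContinuousLinearMap.adjoint_inner_right, hS])
    (by
      intro n k
      simp only [pow_succ', ContinuousLinearMap.mul_apply]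
      generalize (A ^ n) (e 0) = v
      simp [hA, inner_add_right, inner_smul_right, (aux_adj e S hS v).2,
        ContinuousLinearMap.adjoint_inner_right, hS])
  have hs := NormedSpace.exp_series_hasSum_exp' (𝕂 := ℂ) ((Complex.I * t) • A)
  have hs2 := (hs.mapL (ContinuousLinearMap.apply ℂ H (e 0))).mapL (innerSL ℂ (e 0))
  have hinj : Function.Injective (fun p : ℕ => 2 * p) := fun a b h => by
    simpa using h
  rw [← hinj.hasSum_iff] at hs2
  · simp only [ContinuousLinearMap.apply_apply, innerSL_apply_apply] at hs2
    rw [← hs2.tsum_eq]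
    congr 1
    ext p
    have hk := (key (2 * p) 0).1 p rfl
    have h1 : ((2 * p).factorial : ℂ) ≠ 0 := by exact_mod_cast (2 * p).factorial_ne_zero
    simp only [Function.comp, smul_pow, ContinuousLinearMap.smul_apply, inner_smul_right, hk]
    simp only [pow_mul, mul_pow, Complex.I_sq]
    have : (-t ^ 2) ^ p = (-1) ^ p * (t ^ 2) ^ p := by rw [← mul_pow]; ring_nf
    rw [this]
    simp
    field_simp
  · intro n hn
    have hk := (key n 0).2 (fun p hp => hn ⟨p, by simp [hp]⟩)
    simp only [ContinuousLinearMap.apply_apply, innerSL_apply_apply, smul_pow,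
      ContinuousLinearMap.smul_apply, inner_smul_right, hk, mul_zero]

/-- the vacuum expectations of `exp(itP)` and `exp(itX)` coincide and equal
`Σ_{p≥0} (-t²)^p C_p/(2p)!` (with `C_p` the Catalan numbers); for `t ≠ 0` this common
value is `J₁(2t)/t`. -/
theorem statement_8
    {H : Type*} [NormedAddCommGroup H] [InnerProductSpace ℂ H] [CompleteSpace H]
    (e : HilbertBasis ℕ ℂ H)
    (S : H →L[ℂ] H) (hS : ∀ n : ℕ, S (e n) = e (n + 1))
    (T : H →L[ℂ] H) (hT : T = ContinuousLinearMap.adjoint S)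
    (X P : H →L[ℂ] H) (hX : X = S + T) (hP : P = Complex.I • (S - T)) (t : ℂ) :
    ⟪e 0, NormedSpace.exp ((Complex.I * t) • P) (e 0)⟫_ℂ =
        ∑' p : ℕ, (-t ^ 2) ^ p * (((p : ℂ) + 1)⁻¹ * (Nat.choose (2 * p) p : ℂ)) /
          (Nat.factorial (2 * p) : ℂ) ∧
      ⟪e 0, NormedSpace.exp ((Complex.I * t) • X) (e 0)⟫_ℂ =
        ∑' p : ℕ, (-t ^ 2) ^ p * (((p : ℂ) + 1)⁻¹ * (Nat.choose (2 * p) p : ℂ)) /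
          (Nat.factorial (2 * p) : ℂ) ∧
      (t ≠ 0 →
        ⟪e 0, NormedSpace.exp ((Complex.I * t) • P) (e 0)⟫_ℂ = besselJ 1 (2 * t) / t) := by
  have hc : ∀ p : ℕ, (-t ^ 2) ^ p / ((p.factorial : ℂ) * ((p + 1).factorial : ℂ)) =
      (-t ^ 2) ^ p * (((p : ℂ) + 1)⁻¹ * (Nat.choose (2 * p) p : ℂ)) /
          (Nat.factorial (2 * p) : ℂ) := by
    intro p
    have h1 : ((2 * p).factorial : ℂ) ≠ 0 := by exact_mod_cast (2 * p).factorial_ne_zero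
    have h2 : (p.factorial : ℂ) ≠ 0 := by exact_mod_cast p.factorial_ne_zero
    have h3 : (p : ℂ) + 1 ≠ 0 := by exact_mod_cast p.succ_ne_zero
    rw [Nat.cast_choose ℂ (by omega : p ≤ 2 * p), show 2 * p - p = p by omega,
      Nat.factorial_succ]
    push_cast
    field_simp
  have hPe := aux_exp e S hS Complex.I (-Complex.I) (by simp) P
    (by rw [hP, hT, smul_sub, neg_smul, sub_eq_add_neg]) t
  have hXe := aux_exp e S hS 1 1 (by simp) X (by rw [hX, hT, one_smul, one_smul]) t
  refine ⟨?_, ?_, fun ht => ?_⟩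
  · rw [hPe]
    exact tsum_congr hc
  · rw [hXe]
    exact tsum_congr hc
  · rw [hPe, besselJ, ← tsum_div_const]
    refine tsum_congr fun p => ?_
    have h2 : (p.factorial : ℂ) ≠ 0 := by exact_mod_cast p.factorial_ne_zero
    have h4 : ((p + 1).factorial : ℂ) ≠ 0 := by exact_mod_cast (p + 1).factorial_ne_zero
    have : (-t ^ 2) ^ p = (-1) ^ p * (t ^ 2) ^ p := by rw [← mul_pow]; ring_nf
    rw [this, mul_div_cancel_left₀ t two_ne_zero, add_comm 1 p, add_comm 1 (2 * p),
      pow_succ t (2 * p), pow_mul]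
    field_simp
end

section
/- For all m, n ∈ ℕ and all s ∈ ℂ: |I_{0,n}(s)| ≤ (|s|^n/n!)·e^{|s|²}·(1 + |s|²/2), and |I_{m,n}(s)| ≤ (|s|^{m+n}/(m!·n!))·e^{|s|²}·(1 + |s|²/2). -/
lemma term_bound (m n p : ℕ) (s : ℂ) :
    ‖(-1) ^ (p + m) * s ^ (m + n + 2 * p) / (Nat.factorial (m + n + 2 * p) : ℂ) *
    (((m : ℂ) + n + 1) / (2 * (p : ℂ) + m + n + 1)) * (Nat.choose (2 * p + m + n + 1) p : ℂ)‖
    ≤ ‖s‖ ^ (m + n) / ((Nat.factorial m : ℝ) * (Nat.factorial n : ℝ)) *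
      ((‖s‖ ^ 2) ^ p / (Nat.factorial p : ℝ)) := by
  have e1 : ((m : ℂ) + n + 1) = ((m + n + 1 : ℕ) : ℂ) := by push_cast; ring
  have e2 : (2 * (p : ℂ) + m + n + 1) = ((m + n + 2 * p + 1 : ℕ) : ℂ) := by push_cast; ring
  have e3 : 2 * p + m + n + 1 = m + n + 2 * p + 1 := by ring
  rw [e1, e2, e3]
  simp only [norm_mul, norm_div, norm_pow, norm_neg, norm_one, one_pow, one_mul,
    Complex.norm_natCast]
  have hc : (m + n + 2 * p + 1).choose p * p.factorial * (m + n + p + 1).factorial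
      = (m + n + 2 * p + 1) * (m + n + 2 * p).factorial := by
    have h := Nat.choose_mul_factorial_mul_factorial (n := m + n + 2 * p + 1) (k := p) (by omega)
    rw [show m + n + 2 * p + 1 - p = m + n + p + 1 by omega] at h
    rw [h, Nat.factorial_succ]
  have hf : (m + n + 1) * (m.factorial * n.factorial) ≤ (m + n + p + 1).factorial := by
    calc (m + n + 1) * (m.factorial * n.factorial) ≤ (m + n + 1) * (m + n).factorial :=
          Nat.mul_le_mul_left _ (Nat.le_of_dvd (Nat.factorial_pos _)
            (Nat.factorial_mul_factorial_dvd_factorial_add m n))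
      _ = (m + n + 1).factorial := (Nat.factorial_succ _).symm
      _ ≤ _ := Nat.factorial_le (by omega)
  have hc' : ((m + n + 2 * p + 1).choose p : ℝ) * p.factorial * (m + n + p + 1).factorial
      = ((m + n + 2 * p + 1 : ℕ) : ℝ) * (m + n + 2 * p).factorial := by exact_mod_cast hc
  have hf' : ((m + n + 1 : ℕ) : ℝ) * (m.factorial * n.factorial) ≤ (m + n + p + 1).factorial := by
    exact_mod_cast hf
  have p1 : (0 : ℝ) < m.factorial := by exact_mod_cast Nat.factorial_pos _
  have p2 : (0 : ℝ) < n.factorial := by exact_mod_cast Nat.factorial_pos _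
  have p3 : (0 : ℝ) < p.factorial := by exact_mod_cast Nat.factorial_pos _
  have p4 : (0 : ℝ) < (m + n + p + 1).factorial := by exact_mod_cast Nat.factorial_pos _
  have p5 : (0 : ℝ) < (m + n + 2 * p).factorial := by exact_mod_cast Nat.factorial_pos _
  have p6 : (0 : ℝ) < ((m + n + 2 * p + 1 : ℕ) : ℝ) := by exact_mod_cast Nat.succ_pos _
  generalize ((m + n + 2 * p + 1).choose p : ℝ) = C at *
  generalize ((m + n + 2 * p + 1 : ℕ) : ℝ) = A at *
  generalize ((m + n + 1 : ℕ) : ℝ) = B at *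
  generalize ((m + n + p + 1).factorial : ℝ) = F at *
  generalize ((m + n + 2 * p).factorial : ℝ) = G at *
  have hC : C = A * G / (p.factorial * F) := by
    rw [eq_div_iff (by positivity)]; linarith
  have e : ‖s‖ ^ (m + n + 2 * p) / G * (B / A) * C
      = (‖s‖ ^ (m + n) * ((‖s‖ ^ 2) ^ p / p.factorial)) * (B / F) := by
    rw [hC, pow_add, pow_mul]; field_simp
  have hB : B / F ≤ 1 / (m.factorial * n.factorial) := by
    rw [div_le_div_iff₀ p4 (by positivity)]; linarith
  rw [e]
  calc _ ≤ (‖s‖ ^ (m + n) * ((‖s‖ ^ 2) ^ p / p.factorial)) * (1 / (m.factorial * n.factorial)) :=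
        mul_le_mul_of_nonneg_left hB (by positivity)
    _ = _ := by ring

lemma Icoef_bound (m n : ℕ) (s : ℂ) :
    ‖Icoef m n s‖ ≤
        ‖s‖ ^ (m + n) / ((Nat.factorial m : ℝ) * (Nat.factorial n : ℝ)) *
          Real.exp (‖s‖ ^ 2) * (1 + ‖s‖ ^ 2 / 2) := by
  have hs : HasSum (fun p : ℕ => (‖s‖ ^ 2) ^ p / (Nat.factorial p : ℝ)) (Real.exp (‖s‖ ^ 2)) := by
    rw [Real.exp_eq_exp_ℝ]
    exact NormedSpace.expSeries_div_hasSum_exp (‖s‖ ^ 2)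
  have h := tsum_of_norm_bounded (hs.mul_left
    (‖s‖ ^ (m + n) / ((Nat.factorial m : ℝ) * (Nat.factorial n : ℝ))))
    (fun p => term_bound m n p s)
  refine le_trans h (le_mul_of_one_le_right (by positivity) ?_)
  have : 0 ≤ ‖s‖ ^ 2 := by positivity
  linarith


/-- `|I_{0,n}(s)| ≤ (|s|ⁿ/n!) e^{|s|²} (1 + |s|²/2)` and
`|I_{m,n}(s)| ≤ (|s|^{m+n}/(m! n!)) e^{|s|²} (1 + |s|²/2)`. -/
theorem statement_14 (m n : ℕ) (s : ℂ) :
    ‖Icoef 0 n s‖ ≤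
        ‖s‖ ^ n / (Nat.factorial n : ℝ) * Real.exp (‖s‖ ^ 2) *
          (1 + ‖s‖ ^ 2 / 2) ∧
      ‖Icoef m n s‖ ≤
        ‖s‖ ^ (m + n) / ((Nat.factorial m : ℝ) * (Nat.factorial n : ℝ)) *
          Real.exp (‖s‖ ^ 2) * (1 + ‖s‖ ^ 2 / 2) := by
  refine ⟨?_, Icoef_bound m n s⟩
  have h := Icoef_bound 0 n s
  simpa using h
end

section
/- For every real t, the Heisenberg evolution of the creation operator under the free momentum group satisfies the integral formula exp(itP)·S·exp(−itP) = S + ∫₀^t R(exp(isP)e₀) ds, where for u ∈ ℓ²(ℕ), R(u) denotes the rank-one operator ξ ↦ ⟨u, ξ⟩·u, and the integral is a Bochner integral in the Banach space of bounded operators on ℓ²(ℕ). Consequently exp(itP)·X·exp(−itP) = X + 2∫₀^t R(exp(isP)e₀) ds. -/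
open scoped InnerProductSpace

lemma aux_conj {B : Type*} [NormedRing B] [NormedAlgebra ℂ B] [CompleteSpace B]
    (A Y C : B) (h : A * Y - Y * A = C) (t : ℝ) :
    NormedSpace.exp ((t : ℂ) • A) * Y * NormedSpace.exp ((-(t : ℂ)) • A) =
      Y + ∫ s in (0 : ℝ)..t,
        NormedSpace.exp ((s : ℂ) • A) * C * NormedSpace.exp ((-(s : ℂ)) • A) := by
  have d1 : ∀ s : ℝ, HasDerivAt (fun s : ℝ => NormedSpace.exp ((s : ℂ) • A))
      (NormedSpace.exp ((s : ℂ) • A) * A) s := fun s => by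
    have h0 := hasDerivAt_exp_smul_const (𝕂 := ℂ) A (s : ℂ)
    have h1 := h0.scomp s (Complex.ofRealCLM.hasDerivAt (x := s))
    simpa [Function.comp_def] using h1
  have d2 : ∀ s : ℝ, HasDerivAt (fun s : ℝ => NormedSpace.exp ((-(s : ℂ)) • A))
      (-(A * NormedSpace.exp ((-(s : ℂ)) • A))) s := fun s => by
    have h0 := (hasDerivAt_exp_smul_const' (𝕂 := ℂ) A (-(s : ℂ)))
    have h2 := h0.scomp s (Complex.ofRealCLM.hasDerivAt (x := s)).neg
    simpa [Function.comp_def] using h2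
  have d3 : ∀ s : ℝ, HasDerivAt
      (fun s : ℝ => NormedSpace.exp ((s : ℂ) • A) * Y * NormedSpace.exp ((-(s : ℂ)) • A))
      (NormedSpace.exp ((s : ℂ) • A) * C * NormedSpace.exp ((-(s : ℂ)) • A)) s := fun s => by
    have h3 := ((d1 s).mul_const Y).mul (d2 s)
    refine HasDerivAt.congr_deriv (f := fun s : ℝ =>
      NormedSpace.exp ((s : ℂ) • A) * Y * NormedSpace.exp ((-(s : ℂ)) • A)) h3 ?_
    rw [← h]
    generalize NormedSpace.exp ((s : ℂ) • A) = U
    generalize NormedSpace.exp ((-(s : ℂ)) • A) = V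
    noncomm_ring
  have c1 : Continuous (fun s : ℝ => NormedSpace.exp ((s : ℂ) • A)) :=
    continuous_iff_continuousAt.2 fun s => (d1 s).continuousAt
  have c2 : Continuous (fun s : ℝ => NormedSpace.exp ((-(s : ℂ)) • A)) :=
    continuous_iff_continuousAt.2 fun s => (d2 s).continuousAt
  have c3 := (c1.mul (continuous_const (y := C))).mul c2
  rw [intervalIntegral.integral_eq_sub_of_hasDerivAt (fun s _ => d3 s)
    (c3.intervalIntegrable _ _)]
  simp

/-- for real `t`, `e^{itP} S e^{-itP} = S + ∫₀ᵗ R(e^{isP} e₀) ds` and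
`e^{itP} X e^{-itP} = X + 2 ∫₀ᵗ R(e^{isP} e₀) ds`, where `R(u)` is the rank-one
operator `ξ ↦ ⟨u,ξ⟩ u`, the integrals being Bochner integrals in the Banach space of
bounded operators on `ℓ²(ℕ)`. -/
theorem statement_16
    {H : Type*} [NormedAddCommGroup H] [InnerProductSpace ℂ H] [CompleteSpace H]
    (e : HilbertBasis ℕ ℂ H)
    (S : H →L[ℂ] H) (hS : ∀ k : ℕ, S (e k) = e (k + 1))
    (T : H →L[ℂ] H) (hT : T = ContinuousLinearMap.adjoint S)
    (X P : H →L[ℂ] H) (hX : X = S + T) (hP : P = Complex.I • (S - T))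
    (R : H → (H →L[ℂ] H)) (hR : ∀ u : H, R u = (innerSL ℂ u).smulRight u) (t : ℝ) :
    NormedSpace.exp ((Complex.I * t) • P) * S * NormedSpace.exp ((-(Complex.I * t)) • P) =
        S + ∫ s in (0 : ℝ)..t, R (NormedSpace.exp ((Complex.I * s) • P) (e 0)) ∧
      NormedSpace.exp ((Complex.I * t) • P) * X * NormedSpace.exp ((-(Complex.I * t)) • P) =
        X + 2 • ∫ s in (0 : ℝ)..t, R (NormedSpace.exp ((Complex.I * s) • P) (e 0)) := by
  have hd : Dense (Submodule.span ℂ (Set.range e) : Set H) :=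
    Submodule.dense_iff_topologicalClosure_eq_top.2 e.dense_span
  have hinj : ∀ x y : H, (∀ k, ⟪e k, x⟫_ℂ = ⟪e k, y⟫_ℂ) → x = y := fun x y hxy => by
    apply e.repr.injective
    ext k
    rw [e.repr_apply_apply, e.repr_apply_apply, hxy]
  have ho := orthonormal_iff_ite.1 e.orthonormal
  have hT0 : T (e 0) = 0 := by
    apply hinj
    intro k
    rw [hT, ContinuousLinearMap.adjoint_inner_right, hS, ho]
    simp
  have hTs : ∀ k, T (e (k + 1)) = e k := fun k => by
    apply hinj
    intro j
    rw [hT, ContinuousLinearMap.adjoint_inner_right, hS, ho, ho]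
    simp
  have hcomm : T * S - S * T = R (e 0) := by
    apply ContinuousLinearMap.ext_on hd
    rintro _ ⟨k, rfl⟩
    rw [hR]
    cases k with
    | zero => simp [hS, hT0, hTs, e.orthonormal.1 0]
    | succ k => simp [hS, hTs, ho]
  have hA : Complex.I • P = T - S := by
    rw [hP, smul_smul, Complex.I_mul_I]; simp
  have hA1 : ∀ s : ℝ, (Complex.I * s) • P = (s : ℂ) • (T - S) := fun s => by
    rw [← hA, smul_smul, mul_comm]
  have hA2 : ∀ s : ℝ, (-(Complex.I * s)) • P = (-(s : ℂ)) • (T - S) := fun s => by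
    rw [neg_smul, hA1, neg_smul]
  have hstar : ∀ s : ℝ, NormedSpace.exp ((-(s : ℂ)) • (T - S)) =
      ContinuousLinearMap.adjoint (NormedSpace.exp ((s : ℂ) • (T - S))) := fun s => by
    rw [← ContinuousLinearMap.star_eq_adjoint, NormedSpace.star_exp]
    congr 1
    rw [star_smul, star_sub, hT, ← ContinuousLinearMap.star_eq_adjoint, star_star]
    simp only [Complex.star_def, Complex.conj_ofReal]
    rw [neg_smul, ← smul_neg, neg_sub]
  have hRU : ∀ s : ℝ, NormedSpace.exp ((s : ℂ) • (T - S)) * R (e 0) *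
      NormedSpace.exp ((-(s : ℂ)) • (T - S)) =
      R (NormedSpace.exp ((s : ℂ) • (T - S)) (e 0)) := fun s => by
    rw [hstar]
    ext x
    simp [hR, ContinuousLinearMap.adjoint_inner_right]
  simp only [hA1, hA2]
  constructor
  · rw [aux_conj (T - S) S (R (e 0)) (by rw [← hcomm]; noncomm_ring)]
    simp only [hRU]
  · rw [aux_conj (T - S) X ((2 : ℂ) • R (e 0)) (by
      rw [← hcomm, hX, two_smul]; noncomm_ring)]
    simp only [mul_smul_comm, smul_mul_assoc, hRU]
    rw [intervalIntegral.integral_smul, two_smul, two_smul]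
end
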